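/- Let γ = 3 and let (τ,u) be a C¹ solution of the system on ℝ × [0,∞) whose Riemann invariants w = u + φ, z = u − φ are twice continuously differentiable, and set A = w_x, B = z_x. Define y₁ := φ A − (α/(2K_c(1+t)^λ)) ln φ and q₁ := φ B − (α/(2K_c(1+t)^λ)) ln φ. Then y₁′ = −a₂ y₁² − a₁ y₁ + a₀ and q₁‵ = −a₂ q₁² − a₁ q₁ + a₀, where a₂ = K_c > 0, a₁ = α(1 + 2 ln φ)/(2(1+t)^λ), and a₀ = α ln φ · (2λ(1+t)^{λ−1} − α(1 + ln φ))/(4K_c(1+t)^{2λ}). -/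

import Mathlib

open Real Set MeasureTheory

/-- Partial derivative in the space variable `x`. -/
noncomputable def pdx (f : ℝ → ℝ → ℝ) (x t : ℝ) : ℝ := deriv (fun y => f y t) x

/-- Partial derivative in the time variable `t`. -/
noncomputable def pdt (f : ℝ → ℝ → ℝ) (x t : ℝ) : ℝ := deriv (fun s => f x s) t

/-- `(τ, u)` is a `C¹` solution of the compressible Euler equations with
time-dependent damping `τ_t - u_x = 0`, `u_t + p_x = -(α/(1+t)^λ) u`,
`p = K τ^{-γ}`, on `ℝ × [0,∞)`. -/
def IsSol (K γ α lam : ℝ) (τ u : ℝ → ℝ → ℝ) : Prop :=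
  ContDiff ℝ 1 (fun p : ℝ × ℝ => τ p.1 p.2) ∧
  ContDiff ℝ 1 (fun p : ℝ × ℝ => u p.1 p.2) ∧
  (∀ x t, 0 ≤ t → 0 < τ x t) ∧
  (∀ x t, 0 ≤ t → pdt τ x t = pdx u x t) ∧
  (∀ x t, 0 ≤ t →
    pdt u x t + pdx (fun y s => K * τ y s ^ (-γ)) x t = -(α / (1 + t) ^ lam) * u x t)

/-- `φ = (2√(Kγ)/(γ-1)) τ^{-(γ-1)/2}`. -/
noncomputable def Phi (K γ : ℝ) (τ : ℝ → ℝ → ℝ) (x t : ℝ) : ℝ :=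
  (2 * Real.sqrt (K * γ) / (γ - 1)) * τ x t ^ (-(γ - 1) / 2)

/-- `K_τ = (2√(Kγ)/(γ-1))^{2/(γ-1)}`. -/
noncomputable def Ktau (K γ : ℝ) : ℝ := (2 * Real.sqrt (K * γ) / (γ - 1)) ^ (2 / (γ - 1))

/-- `K_c = √(Kγ) K_τ^{-(γ+1)/2}`. -/
noncomputable def Kc (K γ : ℝ) : ℝ := Real.sqrt (K * γ) * Ktau K γ ^ (-(γ + 1) / 2)

/-- Blow-up of `‖(τ_x, u_x)‖_{L^∞}` in finite time. -/
def BlowsUp (τ u : ℝ → ℝ → ℝ) : Prop :=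
  ∃ T > (0 : ℝ),
    ¬ BddAbove {r : ℝ | ∃ x t, 0 ≤ t ∧ t ≤ T ∧ r = |pdx τ x t| + |pdx u x t|}

/-- For `γ = 3`: `φ = √(3K) τ⁻¹`. -/
noncomputable def Phi3 (K : ℝ) (τ : ℝ → ℝ → ℝ) (x t : ℝ) : ℝ :=
  Real.sqrt (3 * K) * (τ x t)⁻¹

/-- For `γ = 3`: `K_c = 1/√(3K)`. -/
noncomputable def Kc3 (K : ℝ) : ℝ := 1 / Real.sqrt (3 * K)

lemma HasFDerivAt.hasDerivAt_fst {F : ℝ × ℝ → ℝ} {F' : ℝ × ℝ →L[ℝ] ℝ} {x t : ℝ}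
    (h : HasFDerivAt F F' (x, t)) : HasDerivAt (fun y => F (y, t)) (F' (1, 0)) x :=
  h.comp_hasDerivAt x ((hasDerivAt_id x).prodMk (hasDerivAt_const x t))

lemma HasFDerivAt.hasDerivAt_snd {F : ℝ × ℝ → ℝ} {F' : ℝ × ℝ →L[ℝ] ℝ} {x t : ℝ}
    (h : HasFDerivAt F F' (x, t)) : HasDerivAt (fun s => F (x, s)) (F' (0, 1)) t :=
  h.comp_hasDerivAt t ((hasDerivAt_const t x).prodMk (hasDerivAt_id t))

section PartialDerivatives

variable {f : ℝ → ℝ → ℝ} {x t : ℝ}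

lemma pdx_eq_fderiv (h : DifferentiableAt ℝ (fun p : ℝ × ℝ => f p.1 p.2) (x, t)) :
    pdx f x t = fderiv ℝ (fun p : ℝ × ℝ => f p.1 p.2) (x, t) (1, 0) :=
  h.hasFDerivAt.hasDerivAt_fst.deriv

lemma pdt_eq_fderiv (h : DifferentiableAt ℝ (fun p : ℝ × ℝ => f p.1 p.2) (x, t)) :
    pdt f x t = fderiv ℝ (fun p : ℝ × ℝ => f p.1 p.2) (x, t) (0, 1) :=
  h.hasFDerivAt.hasDerivAt_snd.deriv

lemma hasDerivAt_pdx (h : DifferentiableAt ℝ (fun p : ℝ × ℝ => f p.1 p.2) (x, t)) :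
    HasDerivAt (fun y => f y t) (pdx f x t) x :=
  h.hasFDerivAt.hasDerivAt_fst.differentiableAt.hasDerivAt

lemma hasDerivAt_pdt (h : DifferentiableAt ℝ (fun p : ℝ × ℝ => f p.1 p.2) (x, t)) :
    HasDerivAt (fun s => f x s) (pdt f x t) t :=
  h.hasFDerivAt.hasDerivAt_snd.differentiableAt.hasDerivAt

lemma contDiff_pdx (h : ContDiff ℝ 2 (fun p : ℝ × ℝ => f p.1 p.2)) :
    ContDiff ℝ 1 (fun p : ℝ × ℝ => pdx f p.1 p.2) := by
  have h1 : (fun p : ℝ × ℝ => pdx f p.1 p.2) =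
      fun p => fderiv ℝ (fun p : ℝ × ℝ => f p.1 p.2) p (1, 0) :=
    funext fun p => pdx_eq_fderiv ((h.differentiable two_ne_zero) p)
  rw [h1]
  exact (h.fderiv_right (m := 1) (by norm_num)).clm_apply contDiff_const

/-- Equality of mixed partial derivatives. -/
lemma pdt_pdx_eq_pdx_pdt (h : ContDiff ℝ 2 (fun p : ℝ × ℝ => f p.1 p.2)) (x t : ℝ) :
    pdt (pdx f) x t = pdx (pdt f) x t := by
  have hd : Differentiable ℝ (fun p : ℝ × ℝ => f p.1 p.2) := h.differentiable two_ne_zero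
  have h2 : DifferentiableAt ℝ (fderiv ℝ (fun p : ℝ × ℝ => f p.1 p.2)) (x, t) :=
    (h.fderiv_right (m := 1) (by norm_num)).differentiable one_ne_zero (x, t)
  have hx : (fun s => pdx f x s) =
      fun s => fderiv ℝ (fun p : ℝ × ℝ => f p.1 p.2) (x, s) (1, 0) :=
    funext fun s => pdx_eq_fderiv (hd (x, s))
  have ht : (fun y => pdt f y t) =
      fun y => fderiv ℝ (fun p : ℝ × ℝ => f p.1 p.2) (y, t) (0, 1) :=
    funext fun y => pdt_eq_fderiv (hd (y, t))
  have e1 := (h2.hasFDerivAt.clm_apply (hasFDerivAt_const ((1 : ℝ), (0 : ℝ)) (x, t))).hasDerivAt_snd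
  have e2 := (h2.hasFDerivAt.clm_apply (hasFDerivAt_const ((0 : ℝ), (1 : ℝ)) (x, t))).hasDerivAt_fst
  have hs : IsSymmSndFDerivAt ℝ (fun p : ℝ × ℝ => f p.1 p.2) (x, t) :=
    h.contDiffAt.isSymmSndFDerivAt (by simp)
  unfold pdt at *
  unfold pdx at *
  rw [hx, ht, e1.deriv, e2.deriv]
  simpa using hs (0, 1) (1, 0)

end PartialDerivatives

section Solution

variable {K α lam : ℝ} {τ u : ℝ → ℝ → ℝ} {x t : ℝ}

lemma Phi3_pos (hK : 0 < K) (hτ : 0 < τ x t) : 0 < Phi3 K τ x t := by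
  unfold Phi3; positivity

lemma differentiableAt_Phi3 (hsol : IsSol K 3 α lam τ u) (ht : 0 ≤ t) :
    DifferentiableAt ℝ (fun p : ℝ × ℝ => Phi3 K τ p.1 p.2) (x, t) :=
  ((hsol.1.differentiable one_ne_zero (x, t)).inv (hsol.2.2.1 x t ht).ne').const_mul _

lemma pdx_Phi3 (hsol : IsSol K 3 α lam τ u) (ht : 0 ≤ t) :
    pdx (Phi3 K τ) x t = Real.sqrt (3 * K) * (-pdx τ x t / τ x t ^ 2) :=
  (((hasDerivAt_pdx (hsol.1.differentiable one_ne_zero (x, t))).inv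
    (hsol.2.2.1 x t ht).ne').const_mul _).deriv

lemma pdt_Phi3 (hK : 0 < K) (hsol : IsSol K 3 α lam τ u) (ht : 0 ≤ t) :
    pdt (Phi3 K τ) x t = -(Kc3 K * Phi3 K τ x t ^ 2) * pdx u x t := by
  have h : pdt (Phi3 K τ) x t = Real.sqrt (3 * K) * (-pdt τ x t / τ x t ^ 2) :=
    (((hasDerivAt_pdt (hsol.1.differentiable one_ne_zero (x, t))).inv
      (hsol.2.2.1 x t ht).ne').const_mul _).deriv
  have hτ := hsol.2.2.1 x t ht
  have hs : 0 < Real.sqrt (3 * K) := by positivity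
  rw [h, hsol.2.2.2.1 x t ht, Kc3, Phi3]
  field_simp

/-- The momentum equation in terms of `φ`. -/
lemma pdt_velocity_eq (hK : 0 < K) (hsol : IsSol K 3 α lam τ u) (ht : 0 ≤ t) :
    pdt u x t = -(α / (1 + t) ^ lam) * u x t -
      Kc3 K * Phi3 K τ x t ^ 2 * pdx (Phi3 K τ) x t := by
  have hτ := hsol.2.2.1 x t ht
  have hp : (fun y => K * τ y t ^ (-3 : ℝ)) = fun y => K * (τ y t ^ 3)⁻¹ := by
    funext y
    rw [Real.rpow_neg (hsol.2.2.1 y t ht).le]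
    norm_cast
  have hpx : pdx (fun y s => K * τ y s ^ (-3 : ℝ)) x t =
      K * (-(3 * τ x t ^ 2 * pdx τ x t) / (τ x t ^ 3) ^ 2) := by
    rw [pdx, hp]
    have h := (((hasDerivAt_pdx (hsol.1.differentiable one_ne_zero (x, t))).pow 3).inv
      (pow_ne_zero 3 hτ.ne')).const_mul K
    simpa using h.deriv
  have hu := hsol.2.2.2.2 x t ht
  rw [hpx] at hu
  have hs : 0 < Real.sqrt (3 * K) := by positivity
  have hs2 : Real.sqrt (3 * K) ^ 2 = 3 * K := Real.sq_sqrt (by positivity)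
  rw [pdx_Phi3 hsol ht, Kc3, Phi3, ← sub_eq_zero, ← sub_eq_zero.mpr hu]
  field_simp
  rw [hs2]
  ring

/-- The Riemann invariant `f = u + σ φ`, `σ = ±1`, along its characteristic. -/
lemma riemannInvariant_eq {σ : ℝ} (hσ : σ ^ 2 = 1) (hK : 0 < K)
    (hsol : IsSol K 3 α lam τ u) {f : ℝ → ℝ → ℝ}
    (hf : f = fun x t => u x t + σ * Phi3 K τ x t) (ht : 0 ≤ t) :
    pdx f x t = pdx u x t + σ * pdx (Phi3 K τ) x t ∧
    pdt f x t = -(α / (1 + t) ^ lam) * u x t -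
      σ * (Kc3 K * Phi3 K τ x t ^ 2) * pdx f x t := by
  have hdu := hsol.2.1.differentiable one_ne_zero (x, t)
  have hdφ := differentiableAt_Phi3 (x := x) hsol ht
  have h1 : pdx f x t = pdx u x t + σ * pdx (Phi3 K τ) x t := by
    rw [hf]
    exact ((hasDerivAt_pdx hdu).add ((hasDerivAt_pdx hdφ).const_mul σ)).deriv
  have h2 : pdt f x t = pdt u x t + σ * pdt (Phi3 K τ) x t := by
    rw [hf]
    exact ((hasDerivAt_pdt hdu).add ((hasDerivAt_pdt hdφ).const_mul σ)).deriv
  refine ⟨h1, ?_⟩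
  rw [h2, h1, pdt_velocity_eq hK hsol ht, pdt_Phi3 hK hsol ht]
  linear_combination (Kc3 K * Phi3 K τ x t ^ 2 * pdx (Phi3 K τ) x t) * hσ

/-- The Riccati equation for the weighted gradient of the Riemann invariant `f = u + σ φ`,
`σ = ±1`, along its characteristic. -/
lemma riccati_weightedGradient {σ : ℝ} (hσ : σ ^ 2 = 1) (hK : 0 < K)
    (hsol : IsSol K 3 α lam τ u) {f y : ℝ → ℝ → ℝ}
    (hf : f = fun x t => u x t + σ * Phi3 K τ x t)
    (hf2 : ContDiff ℝ 2 (fun p : ℝ × ℝ => f p.1 p.2))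
    (hy : y = fun x t => Phi3 K τ x t * pdx f x t -
      α / (2 * Kc3 K * (1 + t) ^ lam) * Real.log (Phi3 K τ x t)) (ht : 0 ≤ t) :
    pdt y x t + σ * (Kc3 K * Phi3 K τ x t ^ 2) * pdx y x t =
      -Kc3 K * y x t ^ 2 -
        α * (1 + 2 * Real.log (Phi3 K τ x t)) / (2 * (1 + t) ^ lam) * y x t +
        α * Real.log (Phi3 K τ x t) *
          (2 * lam * (1 + t) ^ (lam - 1) - α * (1 + Real.log (Phi3 K τ x t))) /
            (4 * Kc3 K * (1 + t) ^ (2 * lam)) := by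
  have hφ : 0 < Phi3 K τ x t := Phi3_pos hK (hsol.2.2.1 x t ht)
  have hk : 0 < Kc3 K := by unfold Kc3; positivity
  have h1t : 0 < 1 + t := by linarith
  have hD : 0 < (1 + t) ^ lam := Real.rpow_pos_of_pos h1t _
  have hdu := hsol.2.1.differentiable one_ne_zero (x, t)
  have hdφ := differentiableAt_Phi3 (x := x) hsol ht
  have hφx := hasDerivAt_pdx hdφ
  have hφt := hasDerivAt_pdt hdφ
  have hdA := (contDiff_pdx hf2).differentiable one_ne_zero (x, t)
  have hAx := hasDerivAt_pdx hdA
  have hAt := hasDerivAt_pdt hdA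
  obtain ⟨hA, -⟩ := riemannInvariant_eq (x := x) hσ hK hsol hf ht
  have hft : (fun y => pdt f y t) = fun y => -(α / (1 + t) ^ lam) * u y t -
      σ * (Kc3 K * Phi3 K τ y t ^ 2) * pdx f y t :=
    funext fun y => (riemannInvariant_eq hσ hK hsol hf ht).2
  have hAt' : pdt (pdx f) x t = -(α / (1 + t) ^ lam) * pdx u x t -
      (σ * (Kc3 K * (2 * Phi3 K τ x t * pdx (Phi3 K τ) x t)) * pdx f x t +
        σ * (Kc3 K * Phi3 K τ x t ^ 2) * pdx (pdx f) x t) := by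
    rw [pdt_pdx_eq_pdx_pdt hf2]
    have h := ((hasDerivAt_pdx hdu).const_mul (-(α / (1 + t) ^ lam))).sub
      ((((hφx.pow 2).const_mul (Kc3 K)).const_mul σ).mul hAx)
    have h' : pdx (pdt f) x t = _ := (congrArg (fun g => deriv g x) hft).trans h.deriv
    rw [h']
    simp
  have hyx : pdx y x t = pdx (Phi3 K τ) x t * pdx f x t + Phi3 K τ x t * pdx (pdx f) x t -
      α / (2 * Kc3 K * (1 + t) ^ lam) * (pdx (Phi3 K τ) x t / Phi3 K τ x t) := by
    rw [hy]
    exact ((hφx.mul hAx).sub ((hφx.log hφ.ne').const_mul _)).deriv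
  have hDt : HasDerivAt (fun s : ℝ => α / (2 * Kc3 K * (1 + s) ^ lam))
      (-(α * lam * (1 + t) ^ (lam - 1)) / (2 * Kc3 K * ((1 + t) ^ lam) ^ 2)) t := by
    have h := (hasDerivAt_const t α).div
      ((((hasDerivAt_id t).const_add 1).rpow_const (p := lam) (Or.inl h1t.ne')).const_mul
        (2 * Kc3 K)) (by simp only [id]; positivity)
    refine h.congr_deriv ?_
    simp only [id]
    field_simp
    ring
  have hyt : pdt y x t = pdt (Phi3 K τ) x t * pdx f x t + Phi3 K τ x t * pdt (pdx f) x t -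
      (-(α * lam * (1 + t) ^ (lam - 1)) / (2 * Kc3 K * ((1 + t) ^ lam) ^ 2) *
          Real.log (Phi3 K τ x t) +
        α / (2 * Kc3 K * (1 + t) ^ lam) * (pdt (Phi3 K τ) x t / Phi3 K τ x t)) := by
    rw [hy]
    exact ((hφt.mul hAt).sub (hDt.mul (hφt.log hφ.ne'))).deriv
  have hD2 : (1 + t) ^ (2 * lam) = ((1 + t) ^ lam) ^ 2 := by
    rw [mul_comm, Real.rpow_mul h1t.le]
    norm_cast
  rw [hyt, hyx, hAt', pdt_Phi3 hK hsol ht, hD2, hy]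
  simp only [hA]
  generalize Real.log (Phi3 K τ x t) = L
  generalize (1 + t) ^ (lam - 1) = E
  generalize (1 + t) ^ lam = D at *
  generalize Phi3 K τ x t = φ at *
  generalize Kc3 K = k at *
  generalize pdx (Phi3 K τ) x t = φx
  generalize pdx u x t = v
  field_simp
  ring

end Solution

theorem stmt12 (K α lam : ℝ) (hK : 0 < K)
    (τ u : ℝ → ℝ → ℝ) (hsol : IsSol K 3 α lam τ u)
    (w z A B c : ℝ → ℝ → ℝ)
    (hw : w = fun x t => u x t + Phi3 K τ x t)
    (hz : z = fun x t => u x t - Phi3 K τ x t)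
    (hw2 : ContDiff ℝ 2 (fun p : ℝ × ℝ => w p.1 p.2))
    (hz2 : ContDiff ℝ 2 (fun p : ℝ × ℝ => z p.1 p.2))
    (hA : A = fun x t => pdx w x t) (hB : B = fun x t => pdx z x t)
    (hc : c = fun x t => Kc3 K * Phi3 K τ x t ^ 2)
    (y₁ q₁ a₀ a₁ : ℝ → ℝ → ℝ) (a₂ : ℝ)
    (hy₁ : y₁ = fun x t =>
      Phi3 K τ x t * A x t - α / (2 * Kc3 K * (1 + t) ^ lam) * Real.log (Phi3 K τ x t))
    (hq₁ : q₁ = fun x t =>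
      Phi3 K τ x t * B x t - α / (2 * Kc3 K * (1 + t) ^ lam) * Real.log (Phi3 K τ x t))
    (ha₂ : a₂ = Kc3 K)
    (ha₁ : a₁ = fun x t => α * (1 + 2 * Real.log (Phi3 K τ x t)) / (2 * (1 + t) ^ lam))
    (ha₀ : a₀ = fun x t => α * Real.log (Phi3 K τ x t) *
      (2 * lam * (1 + t) ^ (lam - 1) - α * (1 + Real.log (Phi3 K τ x t))) /
        (4 * Kc3 K * (1 + t) ^ (2 * lam)))
    (x t : ℝ) (ht : 0 ≤ t) :
    0 < a₂ ∧
    pdt y₁ x t + c x t * pdx y₁ x t = -a₂ * y₁ x t ^ 2 - a₁ x t * y₁ x t + a₀ x t ∧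
    pdt q₁ x t - c x t * pdx q₁ x t = -a₂ * q₁ x t ^ 2 - a₁ x t * q₁ x t + a₀ x t := by
  have hkpos : 0 < Kc3 K := by unfold Kc3; positivity
  subst hA hB hc ha₂ ha₁ ha₀
  refine ⟨hkpos, ?_, ?_⟩
  · have h := riccati_weightedGradient (σ := 1) (x := x) (by norm_num) hK hsol
      (by simpa using hw) hw2 hy₁ ht
    simpa only [one_mul] using h
  · have h := riccati_weightedGradient (σ := -1) (x := x) (by norm_num) hK hsol
      (by simpa [sub_eq_add_neg] using hz) hz2 hq₁ ht
    simpa only [neg_mul, one_mul, ← sub_eq_add_neg] using h
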